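/- Under the diminishing regularization choice (μ_f < 2L_f, γ ≤ 1/(2L_h), η_{0,u} := 1/(γμ_f), η_{0,l} := 2L_f/μ_f, η_k := η_{0,u}/(η_{0,l}+k)), the IR-ISTA averaged iterates satisfy lim_{K→∞} x̄_K = x*, and for every K ≥ 1: −‖∇̃f̄(x*)‖·dist(x̄_K, X*_h̄) + (μ_f/2)‖x̄_K − x*‖² ≤ f̄(x̄_K) − f̄* ≤ u_1/K, where u_1 := ((2L_f − μ_f)/2)·‖x_0 − x*‖². -/

import Mathlib

open scoped RealInnerProductSpace
open Metric Filter

noncomputable section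

section

variable {E : Type*} [NormedAddCommGroup E] [InnerProductSpace ℝ E]

/-- An affine minorant of a strongly convex function that is exact at `p` can be improved by the
quadratic `m / 2 * ‖y - p‖ ^ 2`. -/
lemma StrongConvexOn.quadratic_growth_of_affine_minorant {F : E → ℝ} {m : ℝ}
    (hF : StrongConvexOn Set.univ m F) {p g : E} (hg : ∀ y, F p + ⟪g, y - p⟫ ≤ F y) (y : E) :
    F p + ⟪g, y - p⟫ + m / 2 * ‖y - p‖ ^ 2 ≤ F y := by
  have key : ∀ t ∈ Set.Ioo (0 : ℝ) 1,
      F p + ⟪g, y - p⟫ + (1 - t) * (m / 2 * ‖y - p‖ ^ 2) ≤ F y := by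
    rintro t ⟨ht0, ht1⟩
    have h1 := hF.2 (Set.mem_univ p) (Set.mem_univ y) (sub_nonneg.2 ht1.le) ht0.le
      (sub_add_cancel 1 t)
    have h2 := hg ((1 - t) • p + t • y)
    have h3 : (1 - t) • p + t • y - p = t • (y - p) := by module
    rw [h3, real_inner_smul_right] at h2
    simp only [smul_eq_mul] at h1
    rw [norm_sub_rev p y] at h1
    refine le_of_mul_le_mul_left ?_ ht0
    linarith
  have hlim : Tendsto (fun t : ℝ ↦ F p + ⟪g, y - p⟫ + (1 - t) * (m / 2 * ‖y - p‖ ^ 2))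
      (nhdsWithin 0 (Set.Ioi 0))
      (nhds (F p + ⟪g, y - p⟫ + (1 - 0) * (m / 2 * ‖y - p‖ ^ 2))) := by
    apply Tendsto.mono_left _ nhdsWithin_le_nhds
    apply Continuous.tendsto
    fun_prop
  rw [sub_zero, one_mul] at hlim
  exact le_of_tendsto hlim
    (Filter.eventually_of_mem (Ioo_mem_nhdsGT zero_lt_one) key)

lemma StrongConvexOn.add_convexOn {F φ : E → ℝ} {m : ℝ} (hF : StrongConvexOn Set.univ m F)
    (hφ : ConvexOn ℝ Set.univ φ) : StrongConvexOn Set.univ m fun u ↦ F u + φ u := by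
  rw [strongConvexOn_iff_convex] at hF ⊢
  exact (hF.add hφ).congr fun u _ ↦ by simp only [Pi.add_apply]; ring

lemma strongConvexOn_mul_norm_sub_sq (c : ℝ) (w : E) :
    StrongConvexOn Set.univ (2 * c) fun u ↦ c * ‖u - w‖ ^ 2 := by
  rw [strongConvexOn_iff_convex]
  have h : ConvexOn ℝ Set.univ fun u : E ↦ (-(2 * c)) * ⟪w, u⟫ + c * ‖w‖ ^ 2 :=
    ⟨convex_univ, fun u _ v _ a b _ _ hab ↦ by
      simp only [inner_add_right, real_inner_smul_right, smul_eq_mul]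
      obtain rfl : b = 1 - a := by linarith
      exact le_of_eq (by ring)⟩
  refine h.congr fun u _ ↦ ?_
  simp only
  rw [norm_sub_sq_real, real_inner_comm]
  ring

/-- The three-point inequality for a proximal step. -/
lemma prox_three_point {φ : E → ℝ} (hφ : ConvexOn ℝ Set.univ φ) {c : ℝ} {w p : E}
    (hp : ∀ u, φ p + c * ‖p - w‖ ^ 2 ≤ φ u + c * ‖u - w‖ ^ 2) (u : E) :
    φ p + c * ‖p - w‖ ^ 2 + c * ‖u - p‖ ^ 2 ≤ φ u + c * ‖u - w‖ ^ 2 := by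
  have h := ((strongConvexOn_mul_norm_sub_sq c w).add_convexOn
    hφ).quadratic_growth_of_affine_minorant (p := p) (g := 0)
    (fun y ↦ by simp only [inner_zero_left]; linarith [hp y]) u
  simp only [inner_zero_left] at h
  linarith

variable [CompleteSpace E]

lemma HasGradientAt.hasDerivAt_line {F : E → ℝ} {x d v : E} {t : ℝ}
    (h : HasGradientAt F v (x + t • d)) :
    HasDerivAt (fun s : ℝ ↦ F (x + s • d)) ⟪v, d⟫ t := by
  have h1 : HasDerivAt (fun s : ℝ ↦ x + s • d) d t := by
    simpa using ((hasDerivAt_id t).smul_const d).const_add x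
  have h2 := h.hasFDerivAt.comp_hasDerivAt t h1
  rwa [InnerProductSpace.toDual_apply_apply] at h2

lemma ConvexOn.affine_minorant_of_hasGradientAt {F : E → ℝ} (hF : ConvexOn ℝ Set.univ F)
    {x v : E} (h : HasGradientAt F v x) (y : E) : F x + ⟪v, y - x⟫ ≤ F y := by
  have hline : ConvexOn ℝ Set.univ fun s : ℝ ↦ F (x + s • (y - x)) :=
    ⟨convex_univ, fun s _ t _ a b ha hb hab ↦ by
      have := hF.2 (Set.mem_univ (x + s • (y - x))) (Set.mem_univ (x + t • (y - x))) ha hb hab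
      obtain rfl : b = 1 - a := by linarith
      convert this using 2
      simp only [smul_eq_mul]
      module⟩
  have hd : HasDerivAt (fun s : ℝ ↦ F (x + s • (y - x))) ⟪v, y - x⟫ 0 :=
    HasGradientAt.hasDerivAt_line (by simpa using h)
  have := hline.le_slope_of_hasDerivAt (Set.mem_univ 0) (Set.mem_univ 1) zero_lt_one hd
  simp [slope_def_field] at this
  linarith

/-- The descent lemma. -/
lemma le_quadratic_of_lipschitz_gradient {F : E → ℝ} {F' : E → E} {L : ℝ}
    (hF : ∀ x, HasGradientAt F (F' x) x) (hL : ∀ x y, ‖F' x - F' y‖ ≤ L * ‖x - y‖) (x y : E) :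
    F y ≤ F x + ⟪F' x, y - x⟫ + L / 2 * ‖y - x‖ ^ 2 := by
  set d := y - x with hd
  have hder : ∀ t : ℝ, HasDerivAt
      (fun s : ℝ ↦ F (x + s • d) - (s * ⟪F' x, d⟫ + s ^ 2 * (L / 2 * ‖d‖ ^ 2)))
      (⟪F' (x + t • d), d⟫ - (⟪F' x, d⟫ + 2 * t * (L / 2 * ‖d‖ ^ 2))) t := by
    intro t
    refine (hF _).hasDerivAt_line.sub (HasDerivAt.add ?_ ?_)
    · simpa using (hasDerivAt_id t).mul_const ⟪F' x, d⟫
    · simpa using (hasDerivAt_pow 2 t).mul_const (L / 2 * ‖d‖ ^ 2)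
  have hanti := antitoneOn_of_deriv_nonpos (convex_Icc (0 : ℝ) 1)
    (fun t _ ↦ (hder t).continuousAt.continuousWithinAt)
    (fun t _ ↦ (hder t).differentiableAt.differentiableWithinAt)
    (fun t ht ↦ by
      rw [interior_Icc] at ht
      rw [(hder t).deriv]
      have h1 : ⟪F' (x + t • d) - F' x, d⟫ ≤ L * (t * ‖d‖) * ‖d‖ := by
        refine (real_inner_le_norm _ _).trans (mul_le_mul_of_nonneg_right ?_ (norm_nonneg _))
        simpa [norm_smul, abs_of_pos ht.1] using hL (x + t • d) x
      rw [inner_sub_left] at h1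
      nlinarith)
  have h := hanti (Set.left_mem_Icc.2 zero_le_one) (Set.right_mem_Icc.2 zero_le_one) zero_le_one
  simp [hd] at h
  rw [← hd] at h
  linarith

/-- One step of the regularized proximal gradient method, compared with an arbitrary point `y`. -/
lemma proxGrad_step {f h φ : E → ℝ} {f' h' : E → E} {Lf Lh μ γ η : ℝ}
    (hf : ∀ x, HasGradientAt f (f' x) x) (hfL : ∀ x y, ‖f' x - f' y‖ ≤ Lf * ‖x - y‖)
    (hμ : 0 ≤ μ) (hfsc : StrongConvexOn Set.univ μ f)
    (hh : ∀ x, HasGradientAt h (h' x) x) (hhL : ∀ x y, ‖h' x - h' y‖ ≤ Lh * ‖x - y‖)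
    (hhc : ConvexOn ℝ Set.univ h) (hφ : ConvexOn ℝ Set.univ φ)
    (hγ : 0 < γ) (hη : 0 ≤ η) (hstep : Lh + η * Lf ≤ 1 / γ) {x p : E}
    (hp : ∀ u, φ p + 1 / (2 * γ) * ‖p - (x - γ • (h' x + η • f' x))‖ ^ 2
      ≤ φ u + 1 / (2 * γ) * ‖u - (x - γ • (h' x + η • f' x))‖ ^ 2) (y : E) :
    h p + η * f p + φ p ≤ h y + η * f y + φ y
      + 1 / (2 * γ) * ((1 - η * γ * μ) * ‖x - y‖ ^ 2 - ‖p - y‖ ^ 2) := by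
  have h3 := prox_three_point hφ hp y
  have hexp : ∀ u : E, 1 / (2 * γ) * ‖u - (x - γ • (h' x + η • f' x))‖ ^ 2
      = 1 / (2 * γ) * ‖u - x‖ ^ 2 + (⟪h' x, u - x⟫ + η * ⟪f' x, u - x⟫)
        + 1 / (2 * γ) * ‖γ • (h' x + η • f' x)‖ ^ 2 := by
    intro u
    rw [show u - (x - γ • (h' x + η • f' x)) = (u - x) + γ • (h' x + η • f' x) by abel,
      norm_add_sq_real, real_inner_smul_right, inner_add_right, real_inner_smul_right,
      real_inner_comm (u - x), real_inner_comm (u - x)]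
    field_simp
  rw [hexp p, hexp y] at h3
  have hfc : ConvexOn ℝ Set.univ f := strongConvexOn_zero.1 (hfsc.mono hμ)
  have h4 := hfsc.quadratic_growth_of_affine_minorant
    (hfc.affine_minorant_of_hasGradientAt (hf x)) y
  have h5 := hhc.affine_minorant_of_hasGradientAt (hh x) y
  have h6 := le_quadratic_of_lipschitz_gradient hf hfL x p
  have h7 := le_quadratic_of_lipschitz_gradient hh hhL x p
  have h8 := mul_le_mul_of_nonneg_left h4 hη
  have h9 := mul_le_mul_of_nonneg_left h6 hη
  have h10 := mul_le_mul_of_nonneg_right hstep (sq_nonneg ‖p - x‖)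
  rw [norm_sub_rev x y, norm_sub_rev p y]
  have e1 : 1 / (2 * γ) = 1 / γ / 2 := by field_simp
  have e2 : 1 / (2 * γ) * ((1 - η * γ * μ) * ‖y - x‖ ^ 2 - ‖y - p‖ ^ 2)
      = 1 / γ / 2 * ‖y - x‖ ^ 2 - η * (μ / 2 * ‖y - x‖ ^ 2) - 1 / γ / 2 * ‖y - p‖ ^ 2 := by
    field_simp
  rw [e2]
  rw [e1] at h3
  linarith

end

/-- Nonnegative terms whose sums with weights growing to infinity grow at most linearly have
averages tending to zero. -/
lemma tendsto_average_zero_of_weighted_sum_le {a θ : ℕ → ℝ} {A B : ℝ} (ha : ∀ k, 0 ≤ a k)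
    (hθ_pos : ∀ k, 0 < θ k) (hθ : Monotone θ) (hθ_top : Tendsto θ atTop atTop)
    (hsum : ∀ K : ℕ, ∑ k ∈ Finset.range K, θ k * a k ≤ A + B * K) :
    Tendsto (fun K : ℕ ↦ (K : ℝ)⁻¹ * ∑ k ∈ Finset.range K, a k) atTop (nhds 0) := by
  have hbound : ∀ m K : ℕ, ∑ k ∈ Finset.range K, a k
      ≤ ∑ k ∈ Finset.range m, a k + (A + B * K) / θ m := by
    intro m K
    have h1 : ∀ k ∈ Finset.range K, a k ≤ (if k < m then a k else 0) + θ k * a k / θ m := by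
      intro k _
      split_ifs with hk
      · have := ha k
        have := hθ_pos k
        have := hθ_pos m
        have : 0 ≤ θ k * a k / θ m := by positivity
        linarith
      · rw [zero_add, le_div_iff₀ (hθ_pos m), mul_comm]
        exact mul_le_mul_of_nonneg_right (hθ (not_lt.1 hk)) (ha k)
    refine (Finset.sum_le_sum h1).trans ?_
    rw [Finset.sum_add_distrib, ← Finset.sum_div, ← Finset.sum_filter]
    refine add_le_add (Finset.sum_le_sum_of_subset_of_nonneg ?_ fun k _ _ ↦ ha k)
      (div_le_div_of_nonneg_right (hsum K) (hθ_pos m).le)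
    intro k hk
    exact Finset.mem_range.2 (Finset.mem_filter.1 hk).2
  rw [tendsto_order]
  refine ⟨fun b hb ↦ Eventually.of_forall fun K ↦ hb.trans_le ?_, fun ε hε ↦ ?_⟩
  · exact mul_nonneg (by positivity) (Finset.sum_nonneg fun k _ ↦ ha k)
  obtain ⟨m, hm⟩ := (hθ_top.eventually_gt_atTop (B / ε)).exists
  have hm' : B / θ m < ε := by
    rw [div_lt_iff₀ hε] at hm
    rw [div_lt_iff₀ (hθ_pos m)]
    linarith
  have hlim : Tendsto (fun K : ℕ ↦ (∑ k ∈ Finset.range m, a k + A / θ m) * (K : ℝ)⁻¹ + B / θ m)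
      atTop (nhds ((∑ k ∈ Finset.range m, a k + A / θ m) * 0 + B / θ m)) :=
    (tendsto_inv_atTop_nhds_zero_nat.const_mul _).add_const _
  rw [mul_zero, zero_add] at hlim
  filter_upwards [hlim.eventually_lt_const hm', eventually_ge_atTop 1] with K hK hK1
  refine lt_of_le_of_lt ?_ hK
  have hKpos : (0 : ℝ) < K := by exact_mod_cast hK1
  refine (mul_le_mul_of_nonneg_left (hbound m K) (by positivity)).trans (le_of_eq ?_)
  have := hθ_pos m
  field_simp
  ring

lemma ConvexOn.map_sum_range_average_le {E : Type*} [AddCommGroup E] [Module ℝ E] {F : E → ℝ}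
    (hF : ConvexOn ℝ Set.univ F) (z : ℕ → E) {K : ℕ} (hK : 1 ≤ K) :
    F ((K : ℝ)⁻¹ • ∑ k ∈ Finset.range K, z k) ≤ (K : ℝ)⁻¹ * ∑ k ∈ Finset.range K, F (z k) := by
  have hKpos : (0 : ℝ) < K := by exact_mod_cast hK
  have h := hF.map_sum_le (t := Finset.range K) (w := fun _ ↦ (K : ℝ)⁻¹) (p := z)
    (fun _ _ ↦ by positivity) (by simp [hKpos.ne']) (fun _ _ ↦ Set.mem_univ _)
  simpa only [← Finset.smul_sum, smul_eq_mul, ← Finset.mul_sum] using h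

theorem stmt_12
    {n : ℕ}
    (f h ωf ωh : EuclideanSpace ℝ (Fin n) → ℝ)
    (f' h' : EuclideanSpace ℝ (Fin n) → EuclideanSpace ℝ (Fin n))
    (Lf Lh μf : ℝ)
    (hμf_pos : 0 < μf) (hμf_le : μf ≤ Lf) (hLh_pos : 0 < Lh)
    (hf_grad : ∀ x, HasGradientAt f (f' x) x)
    (hf_lip : ∀ x y, ‖f' x - f' y‖ ≤ Lf * ‖x - y‖)
    (hf_sc : StrongConvexOn Set.univ μf f)
    (hh_grad : ∀ x, HasGradientAt h (h' x) x)
    (hh_lip : ∀ x y, ‖h' x - h' y‖ ≤ Lh * ‖x - y‖)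
    (hh_conv : ConvexOn ℝ Set.univ h)
    (hωf_conv : ConvexOn ℝ Set.univ ωf)
    (hωh_conv : ConvexOn ℝ Set.univ ωh)
    (fbar hbar : EuclideanSpace ℝ (Fin n) → ℝ)
    (hfbar : ∀ x, fbar x = f x + ωf x)
    (hhbar : ∀ x, hbar x = h x + ωh x)
    (X : Set (EuclideanSpace ℝ (Fin n)))
    (hX : X = {z | ∀ y, hbar z ≤ hbar y})
    (hXne : X.Nonempty)
    (hstar : ℝ)
    (hhstar : IsGLB (Set.range hbar) hstar)
    (xstar : EuclideanSpace ℝ (Fin n))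
    (hxstar_mem : xstar ∈ X)
    (hxstar_min : ∀ y ∈ X, fbar xstar ≤ fbar y)
    (g : EuclideanSpace ℝ (Fin n))
    (hg_sub : ∀ y, fbar xstar + ⟪g, y - xstar⟫ ≤ fbar y)
    (hg_opt : ∀ y ∈ X, (0:ℝ) ≤ ⟪g, y - xstar⟫)
    (Cf : ℝ)
    (hCf : IsGLB (Set.range fbar) Cf)
    (x : ℕ → EuclideanSpace ℝ (Fin n))
    (η : ℕ → ℝ) (γ : ℝ)
    (hγ_pos : 0 < γ)
    (hμ2 : μf < 2 * Lf)
    (hγ_le : γ ≤ 1 / (2 * Lh))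
    (η0u η0l : ℝ)
    (hη0u : η0u = 1 / (γ * μf))
    (hη0l : η0l = 2 * Lf / μf)
    (hη : ∀ k : ℕ, η k = η0u / (η0l + (k : ℝ)))
    (hx_iter : ∀ k u,
      ωh (x (k+1)) + η k * ωf (x (k+1))
        + 1 / (2*γ) * ‖x (k+1) - (x k - γ • (h' (x k) + η k • f' (x k)))‖ ^ 2
      ≤ ωh u + η k * ωf u
        + 1 / (2*γ) * ‖u - (x k - γ • (h' (x k) + η k • f' (x k)))‖ ^ 2)
    (θ : ℕ → ℝ)
    (hθ : ∀ k, θ k = 1 / ∏ t ∈ Finset.range (k+1), (1 - η t * γ * μf))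
    (xbar : ℕ → EuclideanSpace ℝ (Fin n))
    (hxbar : ∀ K, xbar K = (∑ j ∈ Finset.range K, θ j * η j)⁻¹ •
        ∑ k ∈ Finset.range K, (θ k * η k) • x (k+1))
    :
    Filter.Tendsto xbar Filter.atTop (nhds xstar)
    ∧ ∀ K : ℕ, 1 ≤ K →
        (-‖g‖ * Metric.infDist (xbar K) X + μf / 2 * ‖xbar K - xstar‖ ^ 2
            ≤ fbar (xbar K) - fbar xstar)
        ∧ fbar (xbar K) - fbar xstar
            ≤ (2 * Lf - μf) / 2 * ‖x 0 - xstar‖ ^ 2 / K := by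
  have hfc : ConvexOn ℝ Set.univ f := strongConvexOn_zero.1 (hf_sc.mono hμf_pos.le)
  have hfbar_sc : StrongConvexOn Set.univ μf fbar := by
    rw [funext hfbar]
    exact hf_sc.add_convexOn hωf_conv
  have hfbar_c : ConvexOn ℝ Set.univ fbar := strongConvexOn_zero.1 (hfbar_sc.mono hμf_pos.le)
  have hhbar_c : ConvexOn ℝ Set.univ hbar := by
    rw [funext hhbar]
    exact hh_conv.add hωh_conv
  have hstar_min : ∀ y, hbar xstar ≤ hbar y := by
    rw [hX] at hxstar_mem
    exact hxstar_mem
  have hLf : 0 < Lf := hμf_pos.trans_le hμf_le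
  have hc : 0 < 2 * Lf - μf := by linarith
  have hden : ∀ k : ℕ, 0 < 2 * Lf + μf * k := fun k ↦ by positivity
  have hηk : ∀ k : ℕ, η k = 1 / (γ * (2 * Lf + μf * k)) := by
    intro k
    have := hden k
    rw [hη, hη0u, hη0l]
    field_simp
  have hη_pos : ∀ k : ℕ, 0 < η k := fun k ↦ by
    have := hden k
    rw [hηk]
    positivity
  have hfac : ∀ k : ℕ, 1 - η k * γ * μf = (2 * Lf + μf * k - μf) / (2 * Lf + μf * k) := by
    intro k
    have := hden k
    rw [hηk]
    field_simp
  have hprod : ∀ k : ℕ, ∏ t ∈ Finset.range k, (1 - η t * γ * μf)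
      = (2 * Lf - μf) / (2 * Lf + μf * k - μf) := by
    intro k
    induction k with
    | zero => simp [hc.ne']
    | succ k ih =>
      have h1 := hden k
      have h2 : 0 < 2 * Lf + μf * k - μf := by
        have : 0 ≤ μf * (k : ℝ) := by positivity
        linarith
      rw [Finset.prod_range_succ, ih, hfac]
      push_cast
      rw [show 2 * Lf + μf * ((k : ℝ) + 1) - μf = 2 * Lf + μf * k by ring]
      field_simp
  have hθk : ∀ k : ℕ, θ k = (2 * Lf + μf * k) / (2 * Lf - μf) := by
    intro k
    rw [hθ, hprod]
    push_cast
    rw [show 2 * Lf + μf * ((k : ℝ) + 1) - μf = 2 * Lf + μf * k by ring, one_div_div]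
  have hθ_pos : ∀ k, 0 < θ k := fun k ↦ by
    rw [hθk]
    exact div_pos (hden k) hc
  have hθη : ∀ k : ℕ, θ k * η k = 1 / (γ * (2 * Lf - μf)) := by
    intro k
    have := hden k
    rw [hθk, hηk]
    field_simp
  have hxbar_avg : ∀ K : ℕ, xbar K = (K : ℝ)⁻¹ • ∑ k ∈ Finset.range K, x (k + 1) := by
    intro K
    rw [hxbar]
    simp only [hθη]
    rw [← Finset.smul_sum, smul_smul, Finset.sum_const, Finset.card_range, nsmul_eq_mul, mul_inv,
      mul_assoc, inv_mul_cancel₀ (by positivity), mul_one]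
  have hstep : ∀ k, Lh + η k * Lf ≤ 1 / γ := by
    intro k
    have h1 : Lh ≤ 1 / γ / 2 := by
      rw [div_div, le_div_iff₀ (by positivity)]
      rw [le_div_iff₀ (by positivity)] at hγ_le
      linarith
    have h2 : η k * Lf ≤ 1 / γ / 2 := by
      have := hden k
      have h0 : 0 ≤ μf * (k : ℝ) := by positivity
      rw [hηk, div_mul_eq_mul_div, div_div, one_mul,
        div_le_div_iff₀ (by positivity) (by positivity)]
      nlinarith
    linarith
  have hone : ∀ k, (hbar (x (k + 1)) - hbar xstar) + η k * (fbar (x (k + 1)) - fbar xstar)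
      ≤ 1 / (2 * γ) * ((1 - η k * γ * μf) * ‖x k - xstar‖ ^ 2 - ‖x (k + 1) - xstar‖ ^ 2) := by
    intro k
    have hφ : ConvexOn ℝ Set.univ fun u ↦ ωh u + η k * ωf u :=
      hωh_conv.add (hωf_conv.smul (hη_pos k).le)
    have h1 := proxGrad_step hf_grad hf_lip hμf_pos.le hf_sc hh_grad hh_lip hh_conv hφ hγ_pos
      (hη_pos k).le (hstep k) (hx_iter k) xstar
    simp only [hfbar, hhbar]
    linarith
  have hsum : ∀ K : ℕ, ∑ k ∈ Finset.range K, θ k * (hbar (x (k + 1)) - hbar xstar)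
      + 1 / (γ * (2 * Lf - μf)) * ∑ k ∈ Finset.range K, (fbar (x (k + 1)) - fbar xstar)
      + 1 / (2 * γ) * ((2 * Lf + μf * K - μf) / (2 * Lf - μf)) * ‖x K - xstar‖ ^ 2
      ≤ 1 / (2 * γ) * ‖x 0 - xstar‖ ^ 2 := by
    intro K
    induction K with
    | zero => simp [hc.ne']
    | succ K ih =>
      have h1 := mul_le_mul_of_nonneg_left (hone K) (hθ_pos K).le
      have h2 : θ K * (1 - η K * γ * μf) = (2 * Lf + μf * K - μf) / (2 * Lf - μf) := by
        have := hden K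
        rw [hθk, hfac]
        field_simp
      have h3 : (2 * Lf + μf * ((K + 1 : ℕ) : ℝ) - μf) / (2 * Lf - μf) = θ K := by
        rw [hθk]
        push_cast
        ring
      rw [Finset.sum_range_succ, Finset.sum_range_succ, h3]
      rw [← h2] at ih
      rw [mul_add, ← mul_assoc (θ K) (η K), hθη] at h1
      linarith
  have hlast : ∀ K : ℕ, 0 ≤ 1 / (2 * γ) * ((2 * Lf + μf * K - μf) / (2 * Lf - μf))
      * ‖x K - xstar‖ ^ 2 := by
    intro K
    have h0 : 0 ≤ μf * (K : ℝ) := by positivity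
    have h1 : 0 ≤ 2 * Lf + μf * K - μf := by linarith
    positivity
  have hgap : ∀ k, 0 ≤ hbar (x (k + 1)) - hbar xstar := fun k ↦ sub_nonneg.2 (hstar_min _)
  have hupper : ∀ K : ℕ, 1 ≤ K →
      fbar (xbar K) - fbar xstar ≤ (2 * Lf - μf) / 2 * ‖x 0 - xstar‖ ^ 2 / K := by
    intro K hK
    have hKpos : (0 : ℝ) < K := by exact_mod_cast hK
    have h1 := hfbar_c.map_sum_range_average_le (fun k ↦ x (k + 1)) hK
    rw [← hxbar_avg] at h1
    have h2 : 0 ≤ ∑ k ∈ Finset.range K, θ k * (hbar (x (k + 1)) - hbar xstar) :=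
      Finset.sum_nonneg fun k _ ↦ mul_nonneg (hθ_pos k).le (hgap k)
    have h3 : 1 / (γ * (2 * Lf - μf)) * ∑ k ∈ Finset.range K, (fbar (x (k + 1)) - fbar xstar)
        ≤ 1 / (2 * γ) * ‖x 0 - xstar‖ ^ 2 := by
      linarith [hsum K, hlast K]
    rw [Finset.sum_sub_distrib, Finset.sum_const, Finset.card_range, nsmul_eq_mul] at h3
    rw [inv_mul_eq_div, le_div_iff₀ hKpos] at h1
    rw [le_div_iff₀ hKpos]
    have h4 := mul_le_mul_of_nonneg_left h3 (mul_pos hγ_pos hc).le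
    rw [← mul_assoc, mul_one_div_cancel (mul_pos hγ_pos hc).ne'] at h4
    have h5 : γ * (2 * Lf - μf) * (1 / (2 * γ) * ‖x 0 - xstar‖ ^ 2)
        = (2 * Lf - μf) / 2 * ‖x 0 - xstar‖ ^ 2 := by
      field_simp
    linarith
  have hgrowth := hfbar_sc.quadratic_growth_of_affine_minorant hg_sub
  have hlower : ∀ y, -‖g‖ * infDist y X + μf / 2 * ‖y - xstar‖ ^ 2 ≤ fbar y - fbar xstar := by
    intro y
    have h1 : -⟪g, y - xstar⟫ ≤ ‖g‖ * infDist y X := by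
      rcases (norm_nonneg g).eq_or_lt with h0 | h0
      · simp [norm_eq_zero.1 h0.symm]
      rw [← div_le_iff₀' h0, le_infDist hXne]
      intro z hz
      rw [div_le_iff₀' h0, dist_comm, dist_eq_norm]
      have h2 := real_inner_le_norm g (z - y)
      have h3 := hg_opt z hz
      rw [← sub_add_sub_cancel z y xstar, inner_add_right] at h3
      linarith
    linarith [hgrowth y]
  refine ⟨?_, fun K hK ↦ ⟨hlower _, hupper K hK⟩⟩
  have hθ_mono : Monotone θ := by
    intro j k hjk
    rw [hθk, hθk]
    gcongr
  have hθ_top : Tendsto θ atTop atTop := by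
    rw [funext hθk]
    exact (tendsto_atTop_add_const_left _ _
      (tendsto_natCast_atTop_atTop.const_mul_atTop hμf_pos)).atTop_div_const hc
  have havg := tendsto_average_zero_of_weighted_sum_le (A := 1 / (2 * γ) * ‖x 0 - xstar‖ ^ 2)
    (B := 1 / (γ * (2 * Lf - μf)) * (fbar xstar - Cf)) hgap hθ_pos hθ_mono hθ_top (by
      intro K
      have h1 : (K : ℝ) * (Cf - fbar xstar)
          ≤ ∑ k ∈ Finset.range K, (fbar (x (k + 1)) - fbar xstar) := by
        have := Finset.card_nsmul_le_sum (Finset.range K)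
          (fun k ↦ fbar (x (k + 1)) - fbar xstar) (Cf - fbar xstar)
          (fun k _ ↦ sub_le_sub_right (hCf.1 (Set.mem_range_self _)) _)
        simpa using this
      have h2 := mul_le_mul_of_nonneg_left h1 (one_div_pos.2 (mul_pos hγ_pos hc)).le
      linarith [hsum K, hlast K])
  have hhbar_le : ∀ K : ℕ, 1 ≤ K → hbar (xbar K)
      ≤ hbar xstar + (K : ℝ)⁻¹ * ∑ k ∈ Finset.range K, (hbar (x (k + 1)) - hbar xstar) := by
    intro K hK
    have hKpos : (0 : ℝ) < K := by exact_mod_cast hK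
    have h1 := hhbar_c.map_sum_range_average_le (fun k ↦ x (k + 1)) hK
    rw [← hxbar_avg] at h1
    rw [Finset.sum_sub_distrib, Finset.sum_const, Finset.card_range, nsmul_eq_mul, mul_sub,
      inv_mul_cancel_left₀ hKpos.ne']
    linarith
  have hfcont : Continuous fbar :=
    continuousOn_univ.1 (hfbar_c.continuousOn isOpen_univ)
  have hhcont : Continuous hbar :=
    continuousOn_univ.1 (hhbar_c.continuousOn isOpen_univ)
  have hf_lim : Tendsto (fun K : ℕ ↦ fbar xstar + (2 * Lf - μf) / 2 * ‖x 0 - xstar‖ ^ 2 / K) atTop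
      (nhds (fbar xstar)) := by
    simpa using (tendsto_const_div_atTop_nhds_zero_nat
      ((2 * Lf - μf) / 2 * ‖x 0 - xstar‖ ^ 2)).const_add (fbar xstar)
  have hh_lim := havg.const_add (hbar xstar)
  rw [add_zero] at hh_lim
  set C := (2 * Lf - μf) / 2 * ‖x 0 - xstar‖ ^ 2 with hC
  have hC0 : 0 ≤ C := by positivity
  have hbdd : ∀ K : ℕ, 1 ≤ K →
      xbar K ∈ closedBall xstar (2 / μf * ‖g‖ + (1 + 2 / μf * C)) := by
    intro K hK
    have hK1 : (1 : ℝ) ≤ K := by exact_mod_cast hK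
    rw [mem_closedBall, dist_eq_norm]
    have h1 := hupper K hK
    have h2 : C / K ≤ C := div_le_self hC0 hK1
    have h3 := hgrowth (xbar K)
    have h4 := real_inner_le_norm (-g) (xbar K - xstar)
    rw [inner_neg_left, norm_neg] at h4
    set r := ‖xbar K - xstar‖
    have h5 : r ^ 2 ≤ 2 / μf * ‖g‖ * r + 2 / μf * C := by
      have h6 : μf / 2 * r ^ 2 ≤ ‖g‖ * r + C := by linarith
      have h7 := mul_le_mul_of_nonneg_left h6 (show 0 ≤ 2 / μf by positivity)
      rw [← mul_assoc, show 2 / μf * (μf / 2) = 1 by field_simp] at h7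
      linarith
    have hp : 0 ≤ 2 / μf * ‖g‖ := by positivity
    have hq : 0 ≤ 2 / μf * C := by positivity
    by_contra! hlt
    nlinarith
  refine (isCompact_closedBall xstar _).tendsto_nhds_of_unique_mapClusterPt
    ((eventually_ge_atTop 1).mono hbdd) fun z _ hz ↦ ?_
  have hcluster : ∀ {F : EuclideanSpace ℝ (Fin n) → ℝ} {u : ℕ → ℝ} {b : ℝ}, Continuous F →
      Tendsto u atTop (nhds b) → (∀ K : ℕ, 1 ≤ K → F (xbar K) ≤ u K) → F z ≤ b := by
    intro F u b hF hu hle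
    by_contra! hlt
    obtain ⟨c, hbc, hcz⟩ := exists_between hlt
    have h1 : ∃ᶠ K in atTop, c < F (xbar K) :=
      hz.frequently ((hF.tendsto z).eventually_const_lt hcz)
    have h2 := hu.eventually_lt_const hbc
    obtain ⟨K, hK, hK2, hK1⟩ := (h1.and_eventually (h2.and (eventually_ge_atTop 1))).exists
    linarith [hle K hK1]
  have hzX : z ∈ X := by
    rw [hX]
    exact fun y ↦ (hcluster hhcont hh_lim hhbar_le).trans (hstar_min y)
  have hzf : fbar z ≤ fbar xstar :=
    hcluster hfcont hf_lim fun K hK ↦ by linarith [hupper K hK]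
  have h1 : μf / 2 * ‖z - xstar‖ ^ 2 ≤ 0 := by linarith [hgrowth z, hg_opt z hzX]
  have h2 : ‖z - xstar‖ ^ 2 ≤ 0 := by
    by_contra! h
    have : 0 < μf / 2 * ‖z - xstar‖ ^ 2 := by positivity
    linarith
  exact sub_eq_zero.1 (norm_eq_zero.1 (pow_eq_zero_iff two_ne_zero |>.1
    (le_antisymm h2 (sq_nonneg _))))
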